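/- Let q, t ∈ ℝ with q ≠ 0, t ≠ 0 and 1 − t²q^j ≠ 0 for every integer j ≥ 0. Then for all y, z ∈ ℝ and all integers n ≥ 1 and 0 ≤ k < n: Σ_{j=0}^{n−k} [n−k choose j]_q · p_j(z|y, tq^k, q) / (t²q^{2k};q)_j · g_{n−k−j}(z|y, tq^{n−1}, q) / (t²q^{n+j+k−1};q)_{n−k−j} = 0. -/

import Mathlib

open Finset

section Defs

variable {K : Type*} [Field K]

/-- q-Pochhammer symbol `(a; q)_n = ∏_{j=0}^{n-1} (1 - a q^j)`. -/
def qPoch (a q : K) (n : ℕ) : K := ∏ j ∈ Finset.range n, (1 - a * q ^ j)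

/-- Gaussian (q-binomial) coefficient `[n choose k]_q`. -/
def qBinom (q : K) : ℕ → ℕ → K
  | _, 0 => 1
  | 0, _ + 1 => 0
  | n + 1, k + 1 => qBinom q n k + q ^ (k + 1) * qBinom q n (k + 1)

/-- Continuous q-Hermite polynomials `h_n(x|q)`:
`h_{-1} = 0`, `h_0 = 1`, `h_{n+1} = 2x h_n - (1 - q^n) h_{n-1}`. -/
def hQH (q x : K) : ℕ → K
  | 0 => 1
  | 1 => 2 * x
  | n + 2 => 2 * x * hQH q x (n + 1) - (1 - q ^ (n + 1)) * hQH q x n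

/-- The polynomials `b_n(x|q) = (-1)^n q^{n(n-1)/2} h_n(x|q^{-1})` (for `q ≠ 0`). -/
def bQH (q x : K) (n : ℕ) : K := (-1) ^ n * q ^ (n * (n - 1) / 2) * hQH q⁻¹ x n

/-- Al-Salam–Chihara polynomials in conjugate-pair parametrization `p_n(x|y,ρ,q)`:
`p_{-1} = 0`, `p_0 = 1`,
`p_{n+1} = 2(x - ρ y q^n) p_n - (1 - q^n)(1 - ρ² q^{n-1}) p_{n-1}`. -/
def pASC (q x y ρ : K) : ℕ → K
  | 0 => 1
  | 1 => 2 * (x - ρ * y)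
  | n + 2 => 2 * (x - ρ * y * q ^ (n + 1)) * pASC q x y ρ (n + 1)
      - (1 - q ^ (n + 1)) * (1 - ρ ^ 2 * q ^ n) * pASC q x y ρ n

open Classical in
/-- The polynomials `g_n(x|y,ρ,q)`: `ρ^n p_n(y|x,ρ⁻¹,q)` for `ρ ≠ 0`, `b_n(x|q)` for `ρ = 0`. -/
noncomputable def gASC (q x y ρ : K) (n : ℕ) : K :=
  if ρ = 0 then bQH q x n else ρ ^ n * pASC q y x ρ⁻¹ n

/-- `ω(u,v|ρ) = (1-ρ²)² - 4uvρ(1+ρ²) + 4ρ²(u²+v²)`. -/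
def omegaW (u v ρ : K) : K :=
  (1 - ρ ^ 2) ^ 2 - 4 * u * v * ρ * (1 + ρ ^ 2) + 4 * ρ ^ 2 * (u ^ 2 + v ^ 2)

/-- `v(x|t) = 1 - 2xt + t²`. -/
def vQH (x t : K) : K := 1 - 2 * x * t + t ^ 2

/-- Coefficient `e_n(a,b,c,d,q)` of the Askey–Wilson three-term recurrence. -/
def eAW (a b c d q : K) (n : ℕ) : K :=
  q ^ ((n : ℤ) - 2) /
      ((1 - a * b * c * d * q ^ (2 * (n : ℤ) - 2)) * (1 - a * b * c * d * q ^ (2 * (n : ℤ)))) *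
    ((a + b + c + d) * (q ^ 2 - a * b * c * d * q ^ (n : ℤ) * (1 + q - q ^ ((n : ℤ) + 1))) +
      (a * b * c + a * b * d + a * c * d + b * c * d) *
        (q - q ^ ((n : ℤ) + 2) - q ^ ((n : ℤ) + 1) + a * b * c * d * q ^ (2 * (n : ℤ))))

/-- Coefficient `f_n(a,b,c,d,q)` of the Askey–Wilson three-term recurrence. -/
def fAW (a b c d q : K) (n : ℕ) : K :=
  (1 - q ^ (n : ℤ)) * (1 - a * b * q ^ ((n : ℤ) - 1)) * (1 - a * c * q ^ ((n : ℤ) - 1)) *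
      (1 - a * d * q ^ ((n : ℤ) - 1)) * (1 - b * c * q ^ ((n : ℤ) - 1)) *
      (1 - b * d * q ^ ((n : ℤ) - 1)) * (1 - c * d * q ^ ((n : ℤ) - 1)) *
      (1 - a * b * c * d * q ^ ((n : ℤ) - 2)) /
    (qPoch (a * b * c * d * q ^ (2 * (n : ℤ) - 3)) q 3 *
      (1 - a * b * c * d * q ^ (2 * (n : ℤ) - 2)))

/-- Monic Askey–Wilson polynomials `α_n(x|a,b,c,d,q)`:
`α_{-1} = 0`, `α_0 = 1`, `α_{n+1} = (2x - e_n) α_n - f_n α_{n-1}`. -/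
def alphaAW (a b c d q x : K) : ℕ → K
  | 0 => 1
  | 1 => 2 * x - eAW a b c d q 0
  | n + 2 => (2 * x - eAW a b c d q (n + 1)) * alphaAW a b c d q x (n + 1) -
      fAW a b c d q (n + 1) * alphaAW a b c d q x n

/-- Coefficient of `ψ_n` in the continuous dual Hahn recurrence:
`q^n (b+c+d) + bcd q^{n-1} (1 - q^{n+1} - q^n)`. -/
def ePsi (b c d q : K) (n : ℕ) : K :=
  q ^ (n : ℤ) * (b + c + d) + b * c * d * q ^ ((n : ℤ) - 1) * (1 - q ^ ((n : ℤ) + 1) - q ^ (n : ℤ))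

/-- Coefficient of `ψ_{n-1}` in the continuous dual Hahn recurrence:
`(1-q^n)(1-bcq^{n-1})(1-bdq^{n-1})(1-cdq^{n-1})`. -/
def fPsi (b c d q : K) (n : ℕ) : K :=
  (1 - q ^ (n : ℤ)) * (1 - b * c * q ^ ((n : ℤ) - 1)) * (1 - b * d * q ^ ((n : ℤ) - 1)) *
    (1 - c * d * q ^ ((n : ℤ) - 1))

/-- Continuous dual Hahn polynomials `ψ_n(x|b,c,d,q)`:
`ψ_{-1} = 0`, `ψ_0 = 1`, `ψ_{n+1} = (2x - ePsi_n) ψ_n - fPsi_n ψ_{n-1}`. -/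
def psiCDH (b c d q x : K) : ℕ → K
  | 0 => 1
  | 1 => 2 * x - ePsi b c d q 0
  | n + 2 => (2 * x - ePsi b c d q (n + 1)) * psiCDH b c d q x (n + 1) -
      fPsi b c d q (n + 1) * psiCDH b c d q x n

/-- Al-Salam–Chihara polynomials `Q_n(x|c,d,q)`:
`Q_{-1} = 0`, `Q_0 = 1`, `Q_{n+1} = (2x - q^n(c+d)) Q_n - (1-q^n)(1-cdq^{n-1}) Q_{n-1}`. -/
def qASC (c d q x : K) : ℕ → K
  | 0 => 1
  | 1 => 2 * x - (c + d)
  | n + 2 => (2 * x - q ^ (n + 1) * (c + d)) * qASC c d q x (n + 1) -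
      (1 - q ^ (n + 1)) * (1 - c * d * q ^ n) * qASC c d q x n

/-- Coefficient `ẽ_n` of the conjugate-pair Askey–Wilson recurrence. -/
def eW (y ρ₁ z ρ₂ q : K) (n : ℕ) : K :=
  2 * q ^ ((n : ℤ) - 1) /
      ((1 - ρ₁ ^ 2 * ρ₂ ^ 2 * q ^ (2 * (n : ℤ) - 2)) *
        (1 - ρ₁ ^ 2 * ρ₂ ^ 2 * q ^ (2 * (n : ℤ)))) *
    (q * (ρ₁ * y + ρ₂ * z) *
        (1 - ρ₁ ^ 2 * ρ₂ ^ 2 * q ^ ((n : ℤ) - 2) * (1 + q - q ^ ((n : ℤ) + 1))) +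
      ρ₁ * ρ₂ * (ρ₁ * z + ρ₂ * y) *
        (1 - q ^ ((n : ℤ) + 1) - q ^ (n : ℤ) + ρ₁ ^ 2 * ρ₂ ^ 2 * q ^ (2 * (n : ℤ) - 1)))

/-- Coefficient `f̃_n` of the conjugate-pair Askey–Wilson recurrence. -/
def fW (y ρ₁ z ρ₂ q : K) (n : ℕ) : K :=
  (1 - q ^ (n : ℤ)) * omegaW y z (ρ₁ * ρ₂ * q ^ ((n : ℤ) - 1)) *
      (1 - ρ₁ ^ 2 * q ^ ((n : ℤ) - 1)) * (1 - ρ₂ ^ 2 * q ^ ((n : ℤ) - 1)) *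
      (1 - ρ₁ ^ 2 * ρ₂ ^ 2 * q ^ ((n : ℤ) - 2)) /
    (qPoch (ρ₁ ^ 2 * ρ₂ ^ 2 * q ^ (2 * (n : ℤ) - 3)) q 3 *
      (1 - ρ₁ ^ 2 * ρ₂ ^ 2 * q ^ (2 * (n : ℤ) - 2)))

/-- Conjugate-pair Askey–Wilson polynomials `w_n(x|y,ρ₁,z,ρ₂,q)`:
`w_{-1} = 0`, `w_0 = 1`, `w_{n+1} = (2x - ẽ_n) w_n - f̃_n w_{n-1}`. -/
def wAW (x y ρ₁ z ρ₂ q : K) : ℕ → K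
  | 0 => 1
  | 1 => 2 * x - eW y ρ₁ z ρ₂ q 0
  | n + 2 => (2 * x - eW y ρ₁ z ρ₂ q (n + 1)) * wAW x y ρ₁ z ρ₂ q (n + 1) -
      fW y ρ₁ z ρ₂ q (n + 1) * wAW x y ρ₁ z ρ₂ q n

/-- Chebyshev polynomials of the second kind. -/
def chebU (x : K) : ℕ → K
  | 0 => 1
  | 1 => 2 * x
  | n + 2 => 2 * x * chebU x (n + 1) - chebU x n

/-- The quantity `A_n` from the Askey–Wilson recurrence factorization. -/
def A_AW (a b c d q : K) (n : ℕ) : K :=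
  (1 - a * b * q ^ (n : ℤ)) * (1 - a * c * q ^ (n : ℤ)) * (1 - a * d * q ^ (n : ℤ)) *
      (1 - a * b * c * d * q ^ ((n : ℤ) - 1)) /
    (a * (1 - a * b * c * d * q ^ (2 * (n : ℤ) - 1)) * (1 - a * b * c * d * q ^ (2 * (n : ℤ))))

/-- The quantity `C_n` from the Askey–Wilson recurrence factorization. -/
def C_AW (a b c d q : K) (n : ℕ) : K :=
  a * (1 - q ^ (n : ℤ)) * (1 - b * c * q ^ ((n : ℤ) - 1)) * (1 - b * d * q ^ ((n : ℤ) - 1)) *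
      (1 - c * d * q ^ ((n : ℤ) - 1)) /
    ((1 - a * b * c * d * q ^ (2 * (n : ℤ) - 2)) * (1 - a * b * c * d * q ^ (2 * (n : ℤ) - 1)))

end Defs

open PowerSeries in
/-- Coefficients of the product of a power series with a quadratic polynomial. -/
theorem coeff_quadratic_mul {K : Type*} [Field K] (a b : K) (F : PowerSeries K) (n : ℕ) :
    coeff (n + 2) ((1 - C a * X + C b * X ^ 2) * F) =
      coeff (n + 2) F - a * coeff (n + 1) F + b * coeff n F := by
  have h1 : coeff (n + 2) (C a * X * F) = a * coeff (n + 1) F := by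
    rw [mul_assoc, coeff_C_mul, show n + 2 = (n + 1) + 1 from rfl, coeff_succ_X_mul]
  have h2 : coeff (n + 2) (C b * X ^ 2 * F) = b * coeff n F := by
    rw [mul_assoc, coeff_C_mul, coeff_X_pow_mul]
  rw [add_mul, sub_mul, one_mul, map_add, map_sub, h1, h2]

open PowerSeries in
theorem coeff_one_quadratic_mul {K : Type*} [Field K] (a b : K) (F : PowerSeries K) :
    coeff 1 ((1 - C a * X + C b * X ^ 2) * F) = coeff 1 F - a * coeff 0 F := by
  have h1 : coeff 1 (C a * X * F) = a * coeff 0 F := by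
    rw [mul_assoc, coeff_C_mul, show 1 = 0 + 1 from rfl, coeff_succ_X_mul]
  have h2 : coeff 1 (C b * X ^ 2 * F) = 0 := by
    rw [mul_assoc, coeff_C_mul, pow_two, mul_assoc, show 1 = 0 + 1 from rfl, coeff_succ_X_mul]
    simp
  rw [add_mul, sub_mul, one_mul, map_add, map_sub, h1, h2, add_zero]

/-- The generating-function factor `1 - 2xρs + ρ²s²` as a power series in `s`. -/
noncomputable def vSeries {K : Type*} [Field K] (x ρ : K) : PowerSeries K :=
  1 - PowerSeries.C (2 * x * ρ) * PowerSeries.X + PowerSeries.C (ρ ^ 2) * PowerSeries.X ^ 2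

theorem constantCoeff_vSeries {K : Type*} [Field K] (x ρ : K) :
    PowerSeries.constantCoeff (vSeries x ρ) = 1 := by
  simp [vSeries]

theorem vSeries_ne_zero {K : Type*} [Field K] (x ρ : K) : vSeries x ρ ≠ 0 := fun h => by
  simpa [h] using constantCoeff_vSeries x ρ

open PowerSeries in
theorem rescale_vSeries {K : Type*} [Field K] (q x ρ : K) :
    rescale q (vSeries x ρ) = vSeries x (ρ * q) := by
  have hC (a : K) : rescale q (C a) = C a := by
    ext n
    rw [coeff_rescale, coeff_C]
    split_ifs with h <;> simp [h]
  simp only [vSeries, map_add, map_sub, map_mul, map_pow, map_one, hC, rescale_X]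
  ring

/-- Series with constant term `1` solving mutually inverse `q`-difference equations are inverse. -/
theorem mul_eq_one_of_rescale {K : Type*} [Field K] {q : K} (hq : ∀ n : ℕ, q ^ (n + 1) ≠ 1)
    {A B F G : PowerSeries K} (hA : A ≠ 0) (hB : B ≠ 0)
    (hF : A * F = B * PowerSeries.rescale q F) (hG : B * G = A * PowerSeries.rescale q G)
    (hF0 : PowerSeries.constantCoeff F = 1) (hG0 : PowerSeries.constantCoeff G = 1) :
    F * G = 1 := by
  have key : F * G = PowerSeries.rescale q (F * G) := by
    apply mul_left_cancel₀ (mul_ne_zero hA hB)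
    rw [map_mul]
    linear_combination B * G * hF + B * PowerSeries.rescale q F * hG
  ext n
  cases n with
  | zero => simp [hF0, hG0]
  | succ n =>
    have := congrArg (PowerSeries.coeff (n + 1)) key
    rw [PowerSeries.coeff_rescale] at this
    have h0 : (1 - q ^ (n + 1)) * PowerSeries.coeff (n + 1) (F * G) = 0 := by
      linear_combination this
    rw [(mul_eq_zero.mp h0).resolve_left (sub_ne_zero.mpr (hq n).symm), PowerSeries.coeff_one]
    simp

/-- The polynomials `g_n(x|y,ρ,q)` defined by their three-term recurrence, for every `ρ`. -/
def gRec {K : Type*} [Field K] (q x y ρ : K) : ℕ → K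
  | 0 => 1
  | 1 => 2 * (ρ * y - x)
  | n + 2 => 2 * (ρ * y - x * q ^ (n + 1)) * gRec q x y ρ (n + 1)
      - (1 - q ^ (n + 1)) * (ρ ^ 2 - q ^ n) * gRec q x y ρ n

theorem gASC_eq_gRec {K : Type*} [Field K] (q x y : K) {ρ : K} (hρ : ρ ≠ 0) (n : ℕ) :
    gASC q x y ρ n = gRec q x y ρ n := by
  simp only [gASC, if_neg hρ]
  induction n using Nat.twoStepInduction with
  | zero => simp [pASC, gRec]
  | one => simp only [pASC, gRec]; field_simp
  | more n ih0 ih1 =>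
    rw [gRec, ← ih0, ← ih1, pASC]
    field_simp
    ring

theorem qPoch_succ {K : Type*} [Field K] (a q : K) (n : ℕ) :
    qPoch a q (n + 1) = qPoch a q n * (1 - a * q ^ n) := by
  simp [qPoch, Finset.prod_range_succ]

theorem qPoch_add {K : Type*} [Field K] (a q : K) (m n : ℕ) :
    qPoch a q (m + n) = qPoch a q m * qPoch (a * q ^ m) q n := by
  simp [qPoch, Finset.prod_range_add, pow_add, mul_assoc]

theorem qPoch_self_ne_zero {K : Type*} [Field K] {q : K} (hq : ∀ n : ℕ, q ^ (n + 1) ≠ 1) (n : ℕ) :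
    qPoch q q n ≠ 0 :=
  Finset.prod_ne_zero_iff.mpr fun j _ => by
    rw [← pow_succ']
    exact sub_ne_zero.mpr (hq j).symm

theorem qBinom_eq_zero_of_lt {K : Type*} [Field K] (q : K) {n k : ℕ} (h : n < k) :
    qBinom q n k = 0 := by
  induction n generalizing k with
  | zero => cases k with
    | zero => omega
    | succ k => rfl
  | succ n ih => cases k with
    | zero => omega
    | succ k => rw [qBinom, ih (by omega), ih (by omega)]; ring

theorem qBinom_zero_right {K : Type*} [Field K] (q : K) (n : ℕ) : qBinom q n 0 = 1 := by
  cases n <;> rfl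

theorem qBinom_mul_qPoch {K : Type*} [Field K] (q : K) (a b : ℕ) :
    qBinom q (a + b) a * (qPoch q q a * qPoch q q b) = qPoch q q (a + b) := by
  induction hs : a + b generalizing a b with
  | zero =>
    obtain ⟨rfl, rfl⟩ : a = 0 ∧ b = 0 := by omega
    simp [qBinom, qPoch]
  | succ s ih =>
    cases a with
    | zero =>
      obtain rfl : b = s + 1 := by omega
      rw [qBinom_zero_right]
      simp [qPoch]
    | succ a =>
      rw [qBinom, qPoch_succ q q s]
      have h1 := ih a b (by omega)
      cases b with
      | zero =>
        obtain rfl : a = s := by omega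
        rw [qBinom_eq_zero_of_lt q (Nat.lt_succ_self a), qPoch_succ]
        linear_combination (1 - q * q ^ a) * h1
      | succ b =>
        have h2 := ih (a + 1) b (by omega)
        obtain rfl : s = a + b + 1 := by omega
        rw [qPoch_succ q q a] at h2 ⊢
        rw [qPoch_succ q q b] at h1 ⊢
        linear_combination (1 - q * q ^ a) * h1 + q ^ (a + 1) * (1 - q * q ^ b) * h2

/-- The generating series `∑ p_n(x|y,ρ,q) sⁿ / (q;q)_n`. -/
noncomputable def pSeries {K : Type*} [Field K] (q x y ρ : K) : PowerSeries K :=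
  PowerSeries.mk fun n => pASC q x y ρ n / qPoch q q n

/-- The generating series `∑ g_n(x|y,ρ,q) sⁿ / (q;q)_n`. -/
noncomputable def gSeries {K : Type*} [Field K] (q x y ρ : K) : PowerSeries K :=
  PowerSeries.mk fun n => gRec q x y ρ n / qPoch q q n

open PowerSeries in
theorem pSeries_rescale {K : Type*} [Field K] {q : K} (hq : ∀ n : ℕ, q ^ (n + 1) ≠ 1)
    (x y ρ : K) :
    vSeries x 1 * pSeries q x y ρ = vSeries y ρ * rescale q (pSeries q x y ρ) := by
  ext n
  rcases n with _ | _ | n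
  · rw [coeff_zero_eq_constantCoeff_apply, coeff_zero_eq_constantCoeff_apply, map_mul, map_mul,
      constantCoeff_vSeries, constantCoeff_vSeries, ← coeff_zero_eq_constantCoeff_apply,
      ← coeff_zero_eq_constantCoeff_apply, coeff_rescale, pow_zero, one_mul,
      one_mul]
  · have h1 : 1 - q ≠ 0 := sub_ne_zero.mpr fun h => hq 0 (by simp [← h])
    simp only [vSeries, zero_add, coeff_one_quadratic_mul, coeff_rescale, pSeries, coeff_mk,
      qPoch_succ, pASC]
    simp only [qPoch, prod_range_zero]
    field_simp
    ring
  · have h0 := qPoch_self_ne_zero hq n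
    have h1 : 1 - q * q ^ n ≠ 0 := by rw [← pow_succ']; exact sub_ne_zero.mpr (hq n).symm
    have h2 : 1 - q * q ^ (n + 1) ≠ 0 := by
      rw [← pow_succ']; exact sub_ne_zero.mpr (hq (n + 1)).symm
    simp only [vSeries, coeff_quadratic_mul, coeff_rescale, pSeries, coeff_mk, qPoch_succ, pASC]
    simp only [pow_add, pow_one] at h1 h2 ⊢
    generalize q ^ n = Q at h1 h2 ⊢
    generalize hD : 1 - q * Q = D at h1 ⊢
    generalize hE : 1 - q * (Q * q) = E at h2 ⊢
    field_simp
    rw [← hD, ← hE]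
    ring

open PowerSeries in
theorem gSeries_rescale {K : Type*} [Field K] {q : K} (hq : ∀ n : ℕ, q ^ (n + 1) ≠ 1)
    (x y ρ : K) :
    vSeries y ρ * gSeries q x y ρ = vSeries x 1 * rescale q (gSeries q x y ρ) := by
  ext n
  rcases n with _ | _ | n
  · rw [coeff_zero_eq_constantCoeff_apply, coeff_zero_eq_constantCoeff_apply, map_mul, map_mul,
      constantCoeff_vSeries, constantCoeff_vSeries, ← coeff_zero_eq_constantCoeff_apply,
      ← coeff_zero_eq_constantCoeff_apply, coeff_rescale, pow_zero, one_mul,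
      one_mul]
  · have h1 : 1 - q ≠ 0 := sub_ne_zero.mpr fun h => hq 0 (by simp [← h])
    simp only [vSeries, zero_add, coeff_one_quadratic_mul, coeff_rescale, gSeries, coeff_mk,
      qPoch_succ, gRec]
    simp only [qPoch, prod_range_zero]
    field_simp
    ring
  · have h0 := qPoch_self_ne_zero hq n
    have h1 : 1 - q * q ^ n ≠ 0 := by rw [← pow_succ']; exact sub_ne_zero.mpr (hq n).symm
    have h2 : 1 - q * q ^ (n + 1) ≠ 0 := by
      rw [← pow_succ']; exact sub_ne_zero.mpr (hq (n + 1)).symm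
    simp only [vSeries, coeff_quadratic_mul, coeff_rescale, gSeries, coeff_mk, qPoch_succ, gRec]
    simp only [pow_add, pow_one] at h1 h2 ⊢
    generalize q ^ n = Q at h1 h2 ⊢
    generalize hD : 1 - q * Q = D at h1 ⊢
    generalize hE : 1 - q * (Q * q) = E at h2 ⊢
    field_simp
    rw [← hD, ← hE]
    ring

theorem constantCoeff_pSeries {K : Type*} [Field K] (q x y ρ : K) :
    PowerSeries.constantCoeff (pSeries q x y ρ) = 1 := by
  rw [← PowerSeries.coeff_zero_eq_constantCoeff_apply]
  simp [pSeries, pASC, qPoch]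

theorem constantCoeff_gSeries {K : Type*} [Field K] (q x y ρ : K) :
    PowerSeries.constantCoeff (gSeries q x y ρ) = 1 := by
  rw [← PowerSeries.coeff_zero_eq_constantCoeff_apply]
  simp [gSeries, gRec, qPoch]

theorem pSeries_mul_gSeries {K : Type*} [Field K] {q : K} (hq : ∀ n : ℕ, q ^ (n + 1) ≠ 1)
    (x y ρ : K) : pSeries q x y ρ * gSeries q x y ρ = 1 :=
  mul_eq_one_of_rescale hq (vSeries_ne_zero x 1) (vSeries_ne_zero y ρ) (pSeries_rescale hq x y ρ)
    (gSeries_rescale hq x y ρ) (constantCoeff_pSeries q x y ρ) (constantCoeff_gSeries q x y ρ)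

theorem gSeries_mul_q {K : Type*} [Field K] {q : K} (hq : ∀ n : ℕ, q ^ (n + 1) ≠ 1)
    (x y ρ : K) : gSeries q x y (ρ * q) = vSeries y ρ * gSeries q x y ρ := by
  have hinv : pSeries q x y (ρ * q) * (vSeries y ρ * gSeries q x y ρ) = 1 := by
    refine mul_eq_one_of_rescale hq (vSeries_ne_zero x 1) (vSeries_ne_zero y (ρ * q))
      (pSeries_rescale hq x y (ρ * q)) ?_ (constantCoeff_pSeries q x y _) ?_
    · rw [map_mul, rescale_vSeries, gSeries_rescale hq]
      ring
    · rw [map_mul, constantCoeff_vSeries, constantCoeff_gSeries, one_mul]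
  have h1 := pSeries_mul_gSeries hq x y (ρ * q)
  exact mul_left_cancel₀ (left_ne_zero_of_mul_eq_one h1) (h1.trans hinv.symm)

/-- The generating series `∑ (ρ²qⁿ;q)_N p_n(x|y,ρ,q) sⁿ / (q;q)_n`. -/
noncomputable def pSeriesWeighted {K : Type*} [Field K] (q x y ρ : K) (N : ℕ) : PowerSeries K :=
  PowerSeries.mk fun n => qPoch (ρ ^ 2 * q ^ n) q N * (pASC q x y ρ n / qPoch q q n)

open PowerSeries in
theorem pSeriesWeighted_succ {K : Type*} [Field K] (q x y ρ : K) (N : ℕ) :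
    pSeriesWeighted q x y ρ (N + 1) = pSeriesWeighted q x y ρ N -
      C (ρ ^ 2 * q ^ N) * rescale q (pSeriesWeighted q x y ρ N) := by
  ext n
  rw [map_sub, coeff_C_mul, coeff_rescale]
  simp only [pSeriesWeighted, coeff_mk, qPoch_succ]
  ring

open PowerSeries in
theorem pSeriesWeighted_mul_gSeries_succ {K : Type*} [Field K] {q : K}
    (hq : ∀ n : ℕ, q ^ (n + 1) ≠ 1) (x y ρ : K) (N : ℕ) :
    pSeriesWeighted q x y ρ (N + 1) * gSeries q x y (ρ * q ^ (N + 1)) =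
      vSeries y (ρ * q ^ N) * (pSeriesWeighted q x y ρ N * gSeries q x y (ρ * q ^ N)) -
      C (ρ ^ 2 * q ^ N) *
        (vSeries x 1 * rescale q (pSeriesWeighted q x y ρ N * gSeries q x y (ρ * q ^ N))) := by
  have h := gSeries_rescale hq x y (ρ * q ^ N)
  rw [pow_succ, ← mul_assoc, gSeries_mul_q hq, pSeriesWeighted_succ,
    map_mul (rescale q)]
  linear_combination -C (ρ ^ 2 * q ^ N) * rescale q (pSeriesWeighted q x y ρ N) * h

open PowerSeries in
/-- The product of the weighted `p`-series with the `g`-series is a polynomial of degree `≤ N`. -/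
theorem coeff_pSeriesWeighted_mul_gSeries {K : Type*} [Field K] {q : K}
    (hq : ∀ n : ℕ, q ^ (n + 1) ≠ 1) (x y ρ : K) {N m : ℕ} (hm : N < m) :
    coeff m (pSeriesWeighted q x y ρ N * gSeries q x y (ρ * q ^ N)) = 0 := by
  induction N generalizing m with
  | zero =>
    have h : pSeriesWeighted q x y ρ 0 = pSeries q x y ρ := by
      simp [pSeriesWeighted, pSeries, qPoch]
    rw [h, pow_zero, mul_one, pSeries_mul_gSeries hq, coeff_one, if_neg (by omega)]
  | succ N ih =>
    obtain ⟨n, rfl⟩ : ∃ n, m = n + 2 := ⟨m - 2, by omega⟩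
    rw [pSeriesWeighted_mul_gSeries_succ hq, map_sub, coeff_C_mul, vSeries, vSeries,
      coeff_quadratic_mul, coeff_quadratic_mul, coeff_rescale, coeff_rescale, coeff_rescale,
      ih (m := n + 2) (by omega), ih (m := n + 1) (by omega)]
    rcases (show N ≤ n by omega).eq_or_lt with rfl | hlt
    · ring
    · rw [ih hlt]
      ring

theorem sum_qBinom_pASC_gRec_of_pow_ne_one {K : Type*} [Field K] {q : K}
    (hq : ∀ n : ℕ, q ^ (n + 1) ≠ 1) (x y ρ : K) {N m : ℕ} (hm : N < m) :
    ∑ j ∈ Finset.range (m + 1), qBinom q m j * qPoch (ρ ^ 2 * q ^ j) q N *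
      pASC q x y ρ j * gRec q x y (ρ * q ^ N) (m - j) = 0 := by
  have h := coeff_pSeriesWeighted_mul_gSeries hq x y ρ hm
  rw [PowerSeries.coeff_mul, Finset.Nat.sum_antidiagonal_eq_sum_range_succ_mk] at h
  rw [← mul_zero (qPoch q q m), ← h, Finset.mul_sum]
  refine Finset.sum_congr rfl fun j hj => ?_
  obtain ⟨b, rfl⟩ := Nat.exists_eq_add_of_le (Finset.mem_range_succ_iff.mp hj)
  rw [← qBinom_mul_qPoch, Nat.add_sub_cancel_left]
  have h1 := qPoch_self_ne_zero hq j
  have h2 := qPoch_self_ne_zero hq b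
  simp only [pSeriesWeighted, gSeries, PowerSeries.coeff_mk]
  field_simp

theorem continuous_qBinom (n k : ℕ) : Continuous fun q : ℝ => qBinom q n k := by
  induction n generalizing k with
  | zero => cases k <;> exact continuous_const
  | succ n ih => cases k with
    | zero => exact continuous_const
    | succ k =>
      simp only [qBinom]
      exact (ih k).add ((continuous_id.pow _).mul (ih (k + 1)))

theorem continuous_pASC (x y ρ : ℝ) (n : ℕ) : Continuous fun q : ℝ => pASC q x y ρ n := by
  induction n using Nat.twoStepInduction with
  | zero => exact continuous_const
  | one => exact continuous_const
  | more n ih0 ih1 =>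
    simp only [pASC]
    fun_prop

theorem continuous_gRec (x y : ℝ) {ρ : ℝ → ℝ} (hρ : Continuous ρ) (n : ℕ) :
    Continuous fun q : ℝ => gRec q x y (ρ q) n := by
  induction n using Nat.twoStepInduction with
  | zero => exact continuous_const
  | one => simp only [gRec]; fun_prop
  | more n ih0 ih1 =>
    simp only [gRec]
    fun_prop

theorem sum_qBinom_pASC_gRec (q x y ρ : ℝ) {N m : ℕ} (hm : N < m) :
    ∑ j ∈ Finset.range (m + 1), qBinom q m j * qPoch (ρ ^ 2 * q ^ j) q N *
      pASC q x y ρ j * gRec q x y (ρ * q ^ N) (m - j) = 0 := by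
  have hdense : Dense ({1, -1}ᶜ : Set ℝ) :=
    (Set.toFinite {1, -1}).countable.dense_compl ℝ
  refine congrFun (Continuous.ext_on (f := fun q : ℝ => ∑ j ∈ Finset.range (m + 1),
    qBinom q m j * qPoch (ρ ^ 2 * q ^ j) q N * pASC q x y ρ j *
      gRec q x y (ρ * q ^ N) (m - j)) (g := fun _ => 0) hdense ?_ continuous_const ?_) q
  · refine continuous_finsetSum _ fun j _ => ?_
    refine (((continuous_qBinom m j).mul ?_).mul (continuous_pASC x y ρ j)).mul
      (continuous_gRec x y (by fun_prop) _)
    simp only [qPoch]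
    fun_prop
  · intro p hp
    refine sum_qBinom_pASC_gRec_of_pow_ne_one (fun n hn => hp ?_) x y ρ hm
    rcases (pow_eq_one_iff_of_ne_zero n.succ_ne_zero).mp hn with h1 | ⟨h1, _⟩ <;> simp [h1]

/-- Corollary (identity i): a vanishing convolution of `p` and `g` polynomials. -/
theorem pASC_gASC_identity_i (q t : ℝ) (hq : q ≠ 0) (ht : t ≠ 0)
    (h : ∀ j : ℕ, 1 - t ^ 2 * q ^ j ≠ 0) (y z : ℝ) (n k : ℕ) (hn : 1 ≤ n) (hk : k < n) :
    ∑ j ∈ Finset.range (n - k + 1),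
        qBinom q (n - k) j *
          (pASC q z y (t * q ^ k) j / qPoch (t ^ 2 * q ^ (2 * k)) q j) *
          (gASC q z y (t * q ^ (n - 1)) (n - k - j) /
            qPoch (t ^ 2 * q ^ (n + j + k - 1)) q (n - k - j)) = 0 := by
  obtain ⟨N, rfl⟩ : ∃ N, n = k + N + 1 := ⟨n - k - 1, by omega⟩
  have hne (a b : ℕ) : qPoch (t ^ 2 * q ^ a) q b ≠ 0 :=
    Finset.prod_ne_zero_iff.mpr fun j _ => by
      rw [mul_assoc, ← pow_add]
      exact h _
  have hsum := sum_qBinom_pASC_gRec q z y (t * q ^ k) (Nat.lt_succ_self N)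
  rw [show k + N + 1 - k = N + 1 by omega, Nat.add_sub_cancel,
    ← zero_div (qPoch (t ^ 2 * q ^ (2 * k)) q (2 * N + 1)), ← hsum, Finset.sum_div]
  refine Finset.sum_congr rfl fun j hj => ?_
  obtain ⟨b, hb⟩ := Nat.exists_eq_add_of_le (Finset.mem_range_succ_iff.mp hj)
  have hsplit : qPoch (t ^ 2 * q ^ (2 * k)) q (2 * N + 1) = qPoch (t ^ 2 * q ^ (2 * k)) q j *
      qPoch (t ^ 2 * q ^ (2 * k + j)) q N * qPoch (t ^ 2 * q ^ (2 * k + j + N)) q b := by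
    rw [show 2 * N + 1 = j + N + b by omega, qPoch_add, qPoch_add]
    simp only [pow_add, mul_assoc]
  rw [hsplit, gASC_eq_gRec q z y (mul_ne_zero ht (pow_ne_zero _ hq)), Nat.succ_eq_add_one,
    show N + 1 - j = b by omega, show k + N + 1 + j + k - 1 = 2 * k + j + N by omega,
    show (t * q ^ k) ^ 2 * q ^ j = t ^ 2 * q ^ (2 * k + j) by ring,
    show t * q ^ k * q ^ N = t * q ^ (k + N) by ring]
  have h1 := hne (2 * k) j
  have h2 := hne (2 * k + j) N
  have h3 := hne (2 * k + j + N) b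
  field_simp
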